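/- Let n ≥ 2 and 0 < λ ≤ Λ, set ñ = (λ/Λ)(n−1) + 1, and assume ñ ≥ 2. Then there exist positive constants e, f > 0 and r₀ ≥ 1, depending only on λ, Λ and n, such that the smooth function Γ(x) = (xₙ/|x|^{ñ}) · ( e·ln|x| + f·(xₙ/|x|)² ) defined for x ∈ ℝⁿ₊ with |x| > r₀ satisfies, in the classical (pointwise) sense, −M⁺_{λ,Λ}(D²Γ(x)) ≤ ( xₙ/|x|^{ñ} )^{(ñ+1)/(ñ−1)} for all x ∈ ℝⁿ₊ with |x| > r₀, where D²Γ(x) is the Hessian matrix of Γ at x. -/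

import Mathlib

open scoped BigOperators

/-- The Pucci maximal operator `M⁺_{λ,Λ}`: for a symmetric matrix it equals
`Λ · (sum of positive eigenvalues) + λ · (sum of negative eigenvalues)`. -/
noncomputable def pucciMax (lam Lam : ℝ) {n : ℕ} (M : Matrix (Fin n) (Fin n) ℝ) : ℝ :=
  if h : M.IsHermitian then
    ∑ i, (Lam * max (h.eigenvalues i) 0 + lam * min (h.eigenvalues i) 0)
  else 0

/-- The Hessian matrix of `φ` at `x`. -/
noncomputable def hess {n : ℕ} (φ : EuclideanSpace ℝ (Fin n) → ℝ)
    (x : EuclideanSpace ℝ (Fin n)) : Matrix (Fin n) (Fin n) ℝ :=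
  fun i j => iteratedFDeriv ℝ 2 φ x ![EuclideanSpace.single i 1, EuclideanSpace.single j 1]

/-- The Pucci maximal operator dominates `λ · trace + (Λ - λ) · (quadratic form at a unit vector)`. -/
theorem le_pucciMax {lam Lam : ℝ} (hLam : lam ≤ Lam) {n : ℕ} {M : Matrix (Fin n) (Fin n) ℝ}
    (hM : M.IsHermitian) {v : EuclideanSpace ℝ (Fin n)} (hv : ‖v‖ = 1) :
    lam * M.trace + (Lam - lam) * (∑ i, ∑ j, v i * M i j * v j) ≤ pucciMax lam Lam M := by
  have hquad : ∑ i, ∑ j, v i * M i j * v j =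
      ∑ l, hM.eigenvalues l * (inner ℝ (hM.eigenvectorBasis l) v) ^ 2 := by
    have h1 : ∑ i, ∑ j, v i * M i j * v j = inner ℝ v (Matrix.toEuclideanLin M v) := by
      rw [PiLp.inner_apply]
      refine Finset.sum_congr rfl fun i _ => ?_
      simp only [RCLike.inner_apply, conj_trivial, Matrix.ofLp_toLpLin, Matrix.toLin'_apply,
        Matrix.mulVec, dotProduct]
      rw [Finset.sum_mul]
      exact Finset.sum_congr rfl fun j _ => by ring
    have hsymm : (Matrix.toEuclideanLin M).IsSymmetric :=
      Matrix.isSymmetric_toEuclideanLin_iff.2 hM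
    rw [h1, ← hM.eigenvectorBasis.sum_inner_mul_inner v (Matrix.toEuclideanLin M v)]
    refine Finset.sum_congr rfl fun l _ => ?_
    have h2 : Matrix.toEuclideanLin M (hM.eigenvectorBasis l) =
        hM.eigenvalues l • hM.eigenvectorBasis l := by
      ext i
      simpa [Matrix.toLpLin_apply] using congrFun (hM.mulVec_eigenvectorBasis l) i
    rw [← hsymm, h2, real_inner_smul_left, real_inner_comm v]
    ring
  have htrace : M.trace = ∑ l, hM.eigenvalues l := by
    simpa using hM.trace_eq_sum_eigenvalues
  rw [pucciMax, dif_pos hM, hquad, htrace, Finset.mul_sum, Finset.mul_sum,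
    ← Finset.sum_add_distrib]
  refine Finset.sum_le_sum fun l _ => ?_
  set c := inner ℝ (hM.eigenvectorBasis l) v with hc
  have hc1 : c ^ 2 ≤ 1 := by
    rw [sq_le_one_iff_abs_le_one]
    simpa [hv] using abs_real_inner_le_norm (hM.eigenvectorBasis l) v
  have hle : hM.eigenvalues l * c ^ 2 ≤ max (hM.eigenvalues l) 0 :=
    calc hM.eigenvalues l * c ^ 2 ≤ max (hM.eigenvalues l) 0 * c ^ 2 := by
          gcongr; exact le_max_left _ _
      _ ≤ max (hM.eigenvalues l) 0 * 1 := by gcongr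
      _ = _ := mul_one _
  have hsum := max_add_min (hM.eigenvalues l) 0
  have := mul_le_mul_of_nonneg_left hle (sub_nonneg.2 hLam)
  linear_combination this - lam * hsum

/-- The Hessian of `z ↦ zₖ a(|z|²) + zₖ³ b(|z|²)` away from the origin. -/
theorem hess_coord_mul_radial {n : ℕ} (k : Fin n) {a a' a'' b b' b'' : ℝ → ℝ}
    (ha : ∀ t, 0 < t → HasDerivAt a (a' t) t) (ha' : ∀ t, 0 < t → HasDerivAt a' (a'' t) t)
    (hb : ∀ t, 0 < t → HasDerivAt b (b' t) t) (hb' : ∀ t, 0 < t → HasDerivAt b' (b'' t) t)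
    {x : EuclideanSpace ℝ (Fin n)} (hx : x ≠ 0) (i j : Fin n) :
    hess (fun z => z k * a (‖z‖ ^ 2) + z k ^ 3 * b (‖z‖ ^ 2)) x i j =
      6 * x k * b (‖x‖ ^ 2) * ((if k = i then 1 else 0) * (if k = j then 1 else 0)) +
      2 * (a' (‖x‖ ^ 2) + 3 * x k ^ 2 * b' (‖x‖ ^ 2)) *
        ((if k = i then 1 else 0) * x j + x i * (if k = j then 1 else 0)) +
      4 * (x k * a'' (‖x‖ ^ 2) + x k ^ 3 * b'' (‖x‖ ^ 2)) * (x i * x j) +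
      2 * (x k * a' (‖x‖ ^ 2) + x k ^ 3 * b' (‖x‖ ^ 2)) * (if i = j then 1 else 0) := by
  have hk : ∀ z : EuclideanSpace ℝ (Fin n), HasFDerivAt (fun z : EuclideanSpace ℝ (Fin n) => z k)
      (EuclideanSpace.proj k : EuclideanSpace ℝ (Fin n) →L[ℝ] ℝ) z :=
    fun z => (EuclideanSpace.proj k : EuclideanSpace ℝ (Fin n) →L[ℝ] ℝ).hasFDerivAt
  obtain ⟨B, hB⟩ : ∃ B : EuclideanSpace ℝ (Fin n) →L[ℝ] EuclideanSpace ℝ (Fin n) →L[ℝ] ℝ,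
      ∀ v w, B v w = inner ℝ v w := ⟨innerSL ℝ, fun _ _ => rfl⟩
  have hrad : ∀ {g g' : ℝ → ℝ}, (∀ t, 0 < t → HasDerivAt g (g' t) t) →
      ∀ z : EuclideanSpace ℝ (Fin n), z ≠ 0 →
        HasFDerivAt (fun z : EuclideanSpace ℝ (Fin n) => g (‖z‖ ^ 2))
          (g' (‖z‖ ^ 2) • ((2 : ℝ) • B z)) z := fun hg z hz =>
    ((hg _ (by positivity)).comp_hasFDerivAt z
      (hasStrictFDerivAt_norm_sq z).hasFDerivAt).congr_fderiv (by ext w; simp [hB])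
  have hfst : ∀ z : EuclideanSpace ℝ (Fin n), z ≠ 0 →
      fderiv ℝ (fun z : EuclideanSpace ℝ (Fin n) => z k * a (‖z‖ ^ 2) + z k ^ 3 * b (‖z‖ ^ 2)) z =
        (a (‖z‖ ^ 2) + 3 * z k ^ 2 * b (‖z‖ ^ 2)) •
            (EuclideanSpace.proj k : EuclideanSpace ℝ (Fin n) →L[ℝ] ℝ) +
          (2 * (z k * a' (‖z‖ ^ 2) + z k ^ 3 * b' (‖z‖ ^ 2))) • B z := by
    intro z hz
    refine HasFDerivAt.fderiv ((((hk z).mul (hrad ha z hz)).add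
      (((hk z).pow 3).mul (hrad hb z hz))).congr_fderiv ?_)
    ext w
    simp
    ring
  have hev : fderiv ℝ (fun z : EuclideanSpace ℝ (Fin n) =>
        z k * a (‖z‖ ^ 2) + z k ^ 3 * b (‖z‖ ^ 2)) =ᶠ[nhds x] fun z =>
        (a (‖z‖ ^ 2) + 3 * z k ^ 2 * b (‖z‖ ^ 2)) •
            (EuclideanSpace.proj k : EuclideanSpace ℝ (Fin n) →L[ℝ] ℝ) +
          (2 * (z k * a' (‖z‖ ^ 2) + z k ^ 3 * b' (‖z‖ ^ 2))) • B z := by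
    filter_upwards [isOpen_ne.mem_nhds hx] with z hz using hfst z hz
  have hc₁ := (hrad ha x hx).add ((((hk x).pow 2).const_mul 3).mul (hrad hb x hx))
  have hc₂ := (((hk x).mul (hrad ha' x hx)).add (((hk x).pow 3).mul (hrad hb' x hx))).const_mul 2
  have hsnd := (hc₁.smul_const (EuclideanSpace.proj k : EuclideanSpace ℝ (Fin n) →L[ℝ] ℝ)).add
    (hc₂.smul B.hasFDerivAt)
  rw [hess, iteratedFDeriv_two_apply, hev.fderiv_eq]
  refine (congrArg (fun A => A (EuclideanSpace.single i (1 : ℝ)) (EuclideanSpace.single j (1 : ℝ)))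
    hsnd.fderiv).trans ?_
  simp [hB, EuclideanSpace.inner_single_right, eq_comm (a := j) (b := i)]
  split_ifs <;> ring

/-- For matrices of the shape arising in `hess_coord_mul_radial`, the trace. -/
theorem trace_coord_radial {n : ℕ} (k : Fin n) (x : EuclideanSpace ℝ (Fin n)) (P Q R S : ℝ)
    {M : Matrix (Fin n) (Fin n) ℝ}
    (hM : ∀ i j, M i j = P * ((if k = i then 1 else 0) * (if k = j then 1 else 0)) +
      Q * ((if k = i then 1 else 0) * x j + x i * (if k = j then 1 else 0)) +
      R * (x i * x j) + S * (if i = j then 1 else 0)) :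
    M.trace = P + 2 * Q * x k + R * ‖x‖ ^ 2 + n * S := by
  simp only [Matrix.trace, Matrix.diag, hM, Finset.sum_add_distrib, ← Finset.mul_sum,
    EuclideanSpace.real_norm_sq_eq]
  simp [← sq]
  ring

/-- For the same matrices, the quadratic form evaluated at `x` itself. -/
theorem quadForm_coord_radial {n : ℕ} (k : Fin n) (x : EuclideanSpace ℝ (Fin n)) (P Q R S : ℝ)
    {M : Matrix (Fin n) (Fin n) ℝ}
    (hM : ∀ i j, M i j = P * ((if k = i then 1 else 0) * (if k = j then 1 else 0)) +
      Q * ((if k = i then 1 else 0) * x j + x i * (if k = j then 1 else 0)) +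
      R * (x i * x j) + S * (if i = j then 1 else 0)) :
    ∑ i, ∑ j, x i * M i j * x j =
      P * x k ^ 2 + 2 * Q * x k * ‖x‖ ^ 2 + R * (‖x‖ ^ 2) ^ 2 + S * ‖x‖ ^ 2 := by
  have hrow : ∀ i, ∑ j, x i * M i j * x j =
      (P * x k + Q * ‖x‖ ^ 2) * (x i * if k = i then 1 else 0) +
        (Q * x k + R * ‖x‖ ^ 2 + S) * x i ^ 2 := by
    intro i
    have : ∀ j, x i * M i j * x j =
        (P * x i * (if k = i then 1 else 0) + Q * x i ^ 2) * ((if k = j then 1 else 0) * x j) +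
        (Q * x i * (if k = i then 1 else 0) + R * x i ^ 2) * x j ^ 2 +
        S * x i * ((if i = j then 1 else 0) * x j) := fun j => by rw [hM]; ring
    simp only [this, Finset.sum_add_distrib, ← Finset.mul_sum, EuclideanSpace.real_norm_sq_eq]
    simp
    split_ifs <;> ring
  simp only [hrow, Finset.sum_add_distrib, ← Finset.mul_sum, ← EuclideanSpace.real_norm_sq_eq]
  simp
  ring

/-- The derivative of `t ↦ t ^ p * (c + d * log t)` on the positive half line. -/
theorem hasDerivAt_rpow_mul_log (p c d : ℝ) {t : ℝ} (ht : 0 < t) :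
    HasDerivAt (fun s : ℝ => s ^ p * (c + d * Real.log s))
      (t ^ (p - 1) * ((p * c + d) + p * d * Real.log t)) t := by
  refine ((Real.hasDerivAt_rpow_const (p := p) (Or.inl ht.ne')).mul
    (((Real.hasDerivAt_log ht.ne').const_mul d).const_add c)).congr_deriv ?_
  rw [show t ^ p = t ^ (p - 1) * t by rw [Real.rpow_sub_one ht.ne']; field_simp]
  field_simp
  ring

/-- With `nt = 2β`, the comparison function is `xₖ |x|^{-nt}` times a radial logarithm plus a cubic
correction, and the Pucci operator is bounded below by the operator with diffusion `Λ` in the radial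
direction and `λ` in the others. -/
theorem neg_le_pucciMax_profile {n : ℕ} (k : Fin n) {lam Lam : ℝ} (hLam : lam ≤ Lam)
    {β e f : ℝ} (hβ : Lam * (2 * β - 1) = lam * ((n : ℝ) - 1))
    (he : e * Lam * (2 * β) = 6 * f * lam) (hf : f * lam * (2 * n + 4) = 1)
    {x : EuclideanSpace ℝ (Fin n)} (hx : x ≠ 0) :
    -(x k ^ 3 * (‖x‖ ^ 2) ^ (-β - 2)) ≤ pucciMax lam Lam
      (hess (fun z : EuclideanSpace ℝ (Fin n) =>
        z k * ((‖z‖ ^ 2) ^ (-β) * (0 + e / 2 * Real.log (‖z‖ ^ 2))) +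
          z k ^ 3 * ((‖z‖ ^ 2) ^ (-β - 1) * (f + 0 * Real.log (‖z‖ ^ 2)))) x) := by
  have hM := hess_coord_mul_radial k
    (fun t ht => hasDerivAt_rpow_mul_log (-β) 0 (e / 2) ht)
    (fun t ht => hasDerivAt_rpow_mul_log _ _ _ ht)
    (fun t ht => hasDerivAt_rpow_mul_log (-β - 1) f 0 ht)
    (fun t ht => hasDerivAt_rpow_mul_log _ _ _ ht) hx
  set M := hess (fun z : EuclideanSpace ℝ (Fin n) =>
        z k * ((‖z‖ ^ 2) ^ (-β) * (0 + e / 2 * Real.log (‖z‖ ^ 2))) +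
          z k ^ 3 * ((‖z‖ ^ 2) ^ (-β - 1) * (f + 0 * Real.log (‖z‖ ^ 2)))) x
  have hherm : M.IsHermitian := by
    ext i j
    simp only [Matrix.conjTranspose_apply, star_trivial, hM, eq_comm (a := j) (b := i)]
    ring
  have hr : 0 < ‖x‖ := norm_pos_iff.2 hx
  have hv : ‖‖x‖⁻¹ • x‖ = 1 := by simp [norm_smul, hr.ne']
  refine le_trans (le_of_eq ?_) (le_pucciMax hLam hherm hv)
  have hquad : ∑ i, ∑ j, (‖x‖⁻¹ • x) i * M i j * (‖x‖⁻¹ • x) j =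
      (‖x‖ ^ 2)⁻¹ * ∑ i, ∑ j, x i * M i j * x j := by
    simp only [Finset.mul_sum, PiLp.smul_apply, smul_eq_mul]
    exact Finset.sum_congr rfl fun i _ => Finset.sum_congr rfl fun j _ => by ring
  rw [hquad, quadForm_coord_radial k x _ _ _ _ hM, trace_coord_radial k x _ _ _ _ hM]
  have ht : 0 < ‖x‖ ^ 2 := by positivity
  generalize ‖x‖ ^ 2 = t at ht
  generalize Real.log t = L
  have h2 : t ^ (-β - 1 - 1) = t ^ (-β - 1 - 1 - 1) * t := by
    rw [Real.rpow_sub_one ht.ne' (-β - 1 - 1)]; field_simp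
  have h1 : t ^ (-β - 1) = t ^ (-β - 1 - 1 - 1) * t ^ 2 := by
    rw [Real.rpow_sub_one ht.ne' (-β - 1 - 1), Real.rpow_sub_one ht.ne' (-β - 1)]; field_simp
  rw [show -β - 2 = -β - 1 - 1 by ring, h1, h2]
  generalize t ^ (-β - 1 - 1 - 1) = T
  generalize x k = y
  field_simp
  linear_combination
    2 * (2 * (y * (e / 2 * T * t * (1 - β * L)) - y ^ 3 * f * (β + 1) * T) + 2 * f * y ^ 3 * T) * hβ +
      2 * y * T * t * he + 2 * y ^ 3 * T * hf

/-- The comparison function written through `|z|²`. -/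
theorem comparison_eq {n : ℕ} (k : Fin n) (nt e f : ℝ) :
    (fun y : EuclideanSpace ℝ (Fin n) =>
        y k / ‖y‖ ^ nt * (e * Real.log ‖y‖ + f * (y k / ‖y‖) ^ 2)) =
      fun z => z k * ((‖z‖ ^ 2) ^ (-(nt / 2)) * (0 + e / 2 * Real.log (‖z‖ ^ 2))) +
          z k ^ 3 * ((‖z‖ ^ 2) ^ (-(nt / 2) - 1) * (f + 0 * Real.log (‖z‖ ^ 2))) := by
  funext z
  rcases eq_or_ne z 0 with rfl | hz
  · simp
  have hr : 0 < ‖z‖ := norm_pos_iff.2 hz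
  have hpow : (‖z‖ ^ 2) ^ (-(nt / 2)) = (‖z‖ ^ nt)⁻¹ := by
    rw [← Real.rpow_natCast, ← Real.rpow_mul hr.le, ← Real.rpow_neg hr.le]
    congr 1
    push_cast
    ring
  rw [Real.rpow_sub_one (by positivity), hpow, Real.log_pow]
  have := Real.rpow_pos_of_pos hr nt
  push_cast
  field_simp
  ring

/-- Since `(nt + 1) / (nt - 1) ≤ 3`, the cubic term is dominated by the power nonlinearity. -/
theorem cube_le_rpow {nt y r : ℝ} (hnt : 2 ≤ nt) (hy : 0 < y) (hyr : y ≤ r) :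
    y ^ 3 * (r ^ 2) ^ (-(nt / 2) - 2) ≤ (y / r ^ nt) ^ ((nt + 1) / (nt - 1)) := by
  have hr : 0 < r := hy.trans_le hyr
  have hnt1 : 0 < nt - 1 := by linarith
  have hs : 0 < y / r := by positivity
  have hlhs : y ^ 3 * (r ^ 2) ^ (-(nt / 2) - 2) = (y / r) ^ (3 : ℝ) * r ^ (-(nt + 1)) := by
    rw [Real.div_rpow hy.le hr.le, ← Real.rpow_natCast r 2, ← Real.rpow_mul hr.le, div_mul_eq_mul_div,
      mul_div_assoc, ← Real.rpow_sub hr, ← Real.rpow_natCast y 3]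
    push_cast
    congr 2
    ring
  have hrhs : (y / r ^ nt) ^ ((nt + 1) / (nt - 1)) =
      (y / r) ^ ((nt + 1) / (nt - 1)) * r ^ (-(nt + 1)) := by
    have : y / r ^ nt = y / r * r ^ (1 - nt) := by
      rw [Real.rpow_sub hr, Real.rpow_one]; field_simp
    rw [this, Real.mul_rpow hs.le (by positivity), ← Real.rpow_mul hr.le]
    congr 2
    field_simp
    ring
  rw [hlhs, hrhs]
  gcongr ?_ * _
  refine Real.rpow_le_rpow_of_exponent_ge hs ((div_le_one hr).2 hyr) ?_
  rw [div_le_iff₀ hnt1]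
  linarith

theorem stmt18 (n : ℕ) (hn : 2 ≤ n) (lam Lam : ℝ) (hlam : 0 < lam) (hLam : lam ≤ Lam)
    (nt : ℝ) (hnt : nt = lam / Lam * ((n : ℝ) - 1) + 1) (hnt2 : 2 ≤ nt) :
    ∃ e f r₀ : ℝ, 0 < e ∧ 0 < f ∧ 1 ≤ r₀ ∧
      ∀ x : EuclideanSpace ℝ (Fin n), 0 < x ⟨n - 1, by omega⟩ → r₀ < ‖x‖ →
        -(pucciMax lam Lam (hess (fun y : EuclideanSpace ℝ (Fin n) =>
            y ⟨n - 1, by omega⟩ / ‖y‖ ^ nt *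
              (e * Real.log ‖y‖ + f * (y ⟨n - 1, by omega⟩ / ‖y‖) ^ 2)) x)) ≤
          (x ⟨n - 1, by omega⟩ / ‖x‖ ^ nt) ^ ((nt + 1) / (nt - 1)) := by
  have hLam0 : 0 < Lam := hlam.trans_le hLam
  have hnt0 : 0 < nt := by linarith
  obtain ⟨f, hf⟩ : ∃ f, f = 1 / (lam * (2 * (n : ℝ) + 4)) := ⟨_, rfl⟩
  obtain ⟨e, he⟩ : ∃ e, e = 6 * f * lam / (Lam * nt) := ⟨_, rfl⟩
  have hf0 : 0 < f := by rw [hf]; positivity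
  have he0 : 0 < e := by rw [he]; positivity
  refine ⟨e, f, 1, he0, hf0, le_rfl, fun x hxk hx1 => ?_⟩
  generalize (⟨n - 1, _⟩ : Fin n) = k at hxk ⊢
  have hr : 0 < ‖x‖ := by linarith
  have hx : x ≠ 0 := norm_pos_iff.1 hr
  have hβ : Lam * (2 * (nt / 2) - 1) = lam * ((n : ℝ) - 1) := by
    rw [hnt]; field_simp; ring
  have he' : e * Lam * (2 * (nt / 2)) = 6 * f * lam := by
    rw [he]; field_simp
  have hf' : f * lam * (2 * n + 4) = 1 := by
    rw [hf]; field_simp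
  have hmain := neg_le_pucciMax_profile k hLam hβ he' hf' hx
  rw [comparison_eq k nt e f]
  refine (neg_le.1 hmain).trans ?_
  exact cube_le_rpow hnt2 hxk ((PiLp.norm_apply_le x k).trans' (le_abs_self _))
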